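/- Let a, c ∈ ℂ and N ∈ ℕ with N ≥ 1. Assume: a+c+m ≠ 0 for every integer 0 ≤ m ≤ 2N; a−c+1−ℓ+i ≠ 0 for all integers 0 ≤ ℓ ≤ N and 0 ≤ i ≤ N−1; 2a+i ≠ 0 for all 0 ≤ i ≤ N−1; 2a+N+i ≠ 0 for all 0 ≤ i ≤ N−1; and 2a−1−2k ≠ 0 as well as (k+2a−1)ⱼ ≠ 0 for all 0 ≤ k ≤ N and relevant j, so that all expressions below are well defined. Define the Hahn rational function Uₖ(ℓ; a, c', N) = Σ_{j=0}^{k} [(−k)ⱼ(−ℓ)ⱼ(k+2a−1)ⱼ] / [(a−c'−ℓ)ⱼ(−N)ⱼ·j!], the weight W(ℓ) = binom(N,ℓ)·(1−a−c−N)_{N−ℓ}·(c−a)ₗ, and the normalization hₖ = (−1)^N · [ (1−2a)·(2a)_N / (1−2a−2k) ] · [ k!·(2a+N)ₖ / ( (−N)ₖ·(2a−1)ₖ ) ]. Then the Hahn rational functions are biorthogonal: for all 0 ≤ s, k ≤ N, Σ_{ℓ=0}^{N} W(ℓ) · U_s(ℓ; a, c−1, N) · Uₖ(N−ℓ; a,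 −c−N, N) = hₖ · δ_{k,s}, where δ is the Kronecker delta. -/

import Mathlib

/-- The Pochhammer symbol `(z)ₘ = z (z+1) ⋯ (z+m-1)`. -/
noncomputable def poch (z : ℂ) (m : ℕ) : ℂ := ∏ i ∈ Finset.range m, (z + i)

/-- The Hahn rational function
`Uₖ(ℓ; a, c', N) = Σ_{j=0}^{k} (-k)ⱼ (-ℓ)ⱼ (k+2a-1)ⱼ / ((a-c'-ℓ)ⱼ (-N)ⱼ j!)`. -/
noncomputable def hahnU (a c' : ℂ) (N k : ℕ) (l : ℂ) : ℂ :=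
  ∑ j ∈ Finset.range (k + 1),
    (poch (-(k : ℂ)) j * poch (-l) j * poch ((k : ℂ) + 2 * a - 1) j) /
      (poch (a - c' - l) j * poch (-(N : ℂ)) j * (Nat.factorial j : ℂ))

/-- The biorthogonality weight `W(ℓ) = binom(N, ℓ) (1-a-c-N)_{N-ℓ} (c-a)ₗ`. -/
noncomputable def hahnW (a c : ℂ) (N l : ℕ) : ℂ :=
  (Nat.choose N l : ℂ) * poch (1 - a - c - N) (N - l) * poch (c - a) l

/-- The normalization
`hₖ = (-1)^N ((1-2a)(2a)_N / (1-2a-2k)) (k! (2a+N)ₖ / ((-N)ₖ (2a-1)ₖ))`. -/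
noncomputable def hahnH (a : ℂ) (N k : ℕ) : ℂ :=
  (-1 : ℂ) ^ N * ((1 - 2 * a) * poch (2 * a) N / (1 - 2 * a - 2 * k)) *
    ((Nat.factorial k : ℂ) * poch (2 * a + N) k /
      (poch (-(N : ℂ)) k * poch (2 * a - 1) k))

theorem poch_zero (z : ℂ) : poch z 0 = 1 := by simp [poch]

theorem poch_succ (z : ℂ) (m : ℕ) : poch z (m + 1) = poch z m * (z + m) := by
  simp [poch, Finset.prod_range_succ]

theorem poch_add (z : ℂ) (m n : ℕ) : poch z (m + n) = poch z m * poch (z + m) n := by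
  simp only [poch, Finset.prod_range_add]
  push_cast
  simp only [add_assoc]

theorem poch_succ_left (z : ℂ) (m : ℕ) : poch z (m + 1) = z * poch (z + 1) m := by
  rw [add_comm m 1, poch_add]
  simp [poch]

theorem poch_ne_zero {z : ℂ} {m : ℕ} (h : ∀ i < m, z + (i : ℂ) ≠ 0) : poch z m ≠ 0 :=
  Finset.prod_ne_zero_iff.2 fun i hi => h i (Finset.mem_range.1 hi)

theorem poch_reflect (z : ℂ) (m : ℕ) : poch z m = (-1) ^ m * poch (1 - z - m) m := by
  induction m generalizing z with
  | zero => simp [poch]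
  | succ m ih =>
    rw [poch_succ, poch_succ_left, ih]
    push_cast
    rw [show 1 - z - ((m : ℂ) + 1) + 1 = 1 - z - m by ring]
    ring

theorem poch_neg_natCast (k i : ℕ) :
    poch (-(k : ℂ)) i = (-1) ^ i * (k.descFactorial i : ℂ) := by
  induction i with
  | zero => simp [poch]
  | succ i ih =>
    rw [poch_succ, ih, Nat.descFactorial_succ]
    rcases le_or_gt i k with h | h
    · push_cast [h]
      ring
    · simp [Nat.descFactorial_of_lt h]

theorem poch_neg_natCast_ne_zero {k i : ℕ} (h : i ≤ k) : poch (-(k : ℂ)) i ≠ 0 := by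
  rw [poch_neg_natCast]
  refine mul_ne_zero (by simp) ?_
  exact_mod_cast (Nat.descFactorial_pos.2 h).ne'

theorem poch_neg_natCast_eq_zero {k i : ℕ} (h : k < i) : poch (-(k : ℂ)) i = 0 := by
  rw [poch_neg_natCast, Nat.descFactorial_of_lt h]
  simp

theorem sum_choose_succ_mul (n : ℕ) (f : ℕ → ℂ) :
    ∑ i ∈ Finset.range (n + 2), ((n + 1).choose i : ℂ) * f i =
      ∑ i ∈ Finset.range (n + 1), (n.choose i : ℂ) * (f i + f (i + 1)) := by
  rw [Finset.sum_range_succ']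
  simp only [Nat.choose_succ_succ, Nat.cast_add, add_mul, mul_add, Finset.sum_add_distrib]
  rw [Finset.sum_range_succ (fun i => (n.choose (i + 1) : ℂ) * f (i + 1)),
    Finset.sum_range_succ' (fun i => (n.choose i : ℂ) * f i)]
  simp
  ring

/-- The Chu–Vandermonde identity. -/
theorem sum_choose_mul_poch_mul_poch (x y : ℂ) (n : ℕ) :
    ∑ i ∈ Finset.range (n + 1), (n.choose i : ℂ) * (poch x i * poch y (n - i)) =
      poch (x + y) n := by
  induction n with
  | zero => simp [poch]
  | succ n ih =>
    rw [sum_choose_succ_mul, poch_succ, ← ih, Finset.sum_mul]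
    refine Finset.sum_congr rfl fun i hi => ?_
    obtain ⟨m, rfl⟩ := Nat.exists_eq_add_of_le (Nat.lt_succ_iff.1 (Finset.mem_range.1 hi))
    rw [show i + m + 1 - i = m + 1 by omega, show i + m + 1 - (i + 1) = m by omega,
      show i + m - i = m by omega, poch_succ, poch_succ]
    push_cast
    ring

/-- The Pfaff–Saalschütz identity, cleared of denominators. -/
theorem sum_choose_saalschutz (a b c : ℂ) (n : ℕ) :
    ∑ i ∈ Finset.range (n + 1), (n.choose i : ℂ) *
        (poch a i * poch b i * poch (c + i) (n - i) * poch (c - a - b) (n - i)) =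
      poch (c - a) n * poch (c - b) n := by
  induction n with
  | zero => simp [poch]
  | succ n ih =>
    set K : ℕ → ℂ := fun i => i * (n.choose i : ℂ) * poch a i * poch b i *
      poch (c - a - b) (n + 1 - i) * poch (c + i) (n - i) with hK
    have tele : ∑ i ∈ Finset.range (n + 1), (K (i + 1) - K i) = 0 := by
      rw [Finset.sum_range_sub]
      simp [hK]
    rw [sum_choose_succ_mul, poch_succ, poch_succ,
      show poch (c - a) n * (c - a + n) * (poch (c - b) n * (c - b + n)) =
        poch (c - a) n * poch (c - b) n * ((c - a + n) * (c - b + n)) by ring,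
      ← ih, Finset.sum_mul, ← sub_eq_zero, ← tele, ← Finset.sum_sub_distrib]
    refine Finset.sum_congr rfl fun i hi => ?_
    simp only [hK]
    rcases (Nat.lt_succ_iff.1 (Finset.mem_range.1 hi)).eq_or_lt with rfl | hlt
    · rw [show i + 1 - i = 1 by omega]
      simp [poch_succ, poch_zero]
      ring
    · obtain ⟨m, rfl⟩ := Nat.exists_eq_add_of_lt hlt
      have hc := Nat.choose_succ_right_eq (i + m + 1) i
      rw [show i + m + 1 - i = m + 1 by omega] at hc
      have hc' : ((i + m + 1).choose (i + 1) : ℂ) * (i + 1) =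
        (i + m + 1).choose i * (m + 1) := by exact_mod_cast hc
      rw [show i + m + 1 + 1 - i = m + 1 + 1 by omega,
        show i + m + 1 + 1 - (i + 1) = m + 1 by omega,
        show i + m + 1 - i = m + 1 by omega, show i + m + 1 - (i + 1) = m by omega]
      simp only [poch_succ a, poch_succ b, poch_succ (c - a - b)]
      push_cast
      rw [poch_succ (c + i) (m + 1), poch_succ_left (c + i) m, ← add_assoc c,
        poch_succ (c + i + 1) m]
      push_cast
      linear_combination (-(poch a i * (a + i) * (poch b i * (b + i)) *
        (poch (c - a - b) m * (c - a - b + m)) * poch (c + i + 1) m)) * hc'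

theorem choose_mul_descFactorial_mul_descFactorial (p j q i : ℕ) :
    (p + j + (q + i)).choose (p + j) * (p + j).descFactorial j * (q + i).descFactorial i =
      (p + j + (q + i)).descFactorial (j + i) * (p + q).choose p := by
  have h1 := Nat.factorial_mul_descFactorial (Nat.le_add_left j p)
  have h2 := Nat.factorial_mul_descFactorial (Nat.le_add_left i q)
  have h3 := Nat.factorial_mul_descFactorial (show j + i ≤ p + j + (q + i) by omega)
  have h4 := Nat.add_choose_mul_factorial_mul_factorial (p + j) (q + i)
  have h5 := Nat.add_choose_mul_factorial_mul_factorial p q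
  rw [← Nat.choose_symm_add] at h4 h5
  rw [Nat.add_sub_cancel] at h1 h2
  rw [show p + j + (q + i) - (j + i) = p + q by omega, ← h5] at h3
  rw [← h1, ← h2, ← h3] at h4
  refine Nat.eq_of_mul_eq_mul_left (Nat.mul_pos p.factorial_pos q.factorial_pos) ?_
  linarith

/-- The moments of the Hahn weight against the building blocks of the rational functions. -/
theorem sum_hahnW_mul (a c : ℂ) (N i j : ℕ)
    (hac : ∀ m ≤ 2 * N, a + c + (m : ℂ) ≠ 0)
    (h1 : ∀ l ≤ N, ∀ i ≤ N - 1, a - c + 1 - (l : ℂ) + (i : ℂ) ≠ 0)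
    (hx : ∀ i < 2 * N, 2 * a + (i : ℂ) ≠ 0) :
    ∑ l ∈ Finset.range (N + 1), hahnW a c N l *
        (poch (-(l : ℂ)) j / poch (a - (c - 1) - l) j) *
        (poch (-((N : ℂ) - l)) i / poch (a - (-c - N) - ((N : ℂ) - l)) i) =
      (-1) ^ N * poch (2 * a) N * (poch (-(N : ℂ)) (j + i) / poch (2 * a) (j + i)) := by
  have key : ∀ l ∈ Finset.range (N + 1), ∀ q : ℕ, N = l + q → -((N : ℂ) - l) = -(q : ℂ) := by
    rintro l - q rfl
    push_cast
    ring
  rcases lt_or_ge N (j + i) with hlt | hle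
  · rw [poch_neg_natCast_eq_zero hlt, zero_div, mul_zero]
    refine Finset.sum_eq_zero fun l hl => ?_
    obtain ⟨q, hq⟩ := Nat.exists_eq_add_of_le (Nat.lt_succ_iff.1 (Finset.mem_range.1 hl))
    rw [key l hl q hq]
    rcases lt_or_ge l j with h | h
    · simp [poch_neg_natCast_eq_zero h]
    · simp [poch_neg_natCast_eq_zero (show q < i by omega)]
  · obtain ⟨M, hM⟩ := Nat.exists_eq_add_of_le hle
    have hN1 : N + 1 = j + (M + 1) + i := by omega
    rw [hN1, Finset.sum_range_add, Finset.sum_range_add]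
    rw [Finset.sum_eq_zero (s := Finset.range j), Finset.sum_eq_zero (s := Finset.range i),
      zero_add, add_zero]
    rotate_left
    · intro p hp
      have hp := Finset.mem_range.1 hp
      obtain ⟨q, hq⟩ := Nat.exists_eq_add_of_le (show j + (M + 1) + p ≤ N by omega)
      rw [key _ (Finset.mem_range.2 (by omega)) q hq,
        poch_neg_natCast_eq_zero (show q < i by omega)]
      simp
    · intro p hp
      rw [poch_neg_natCast_eq_zero (Finset.mem_range.1 hp)]
      simp
    have hterm : ∀ p ∈ Finset.range (M + 1), hahnW a c N (j + p) *
        (poch (-((j + p : ℕ) : ℂ)) j / poch (a - (c - 1) - (j + p : ℕ)) j) *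
        (poch (-((N : ℂ) - (j + p : ℕ))) i /
          poch (a - (-c - N) - ((N : ℂ) - (j + p : ℕ))) i) =
        (N.descFactorial (j + i) : ℂ) *
          ((M.choose p : ℂ) * (poch (c - a) p * poch (1 - a - c - N) (M - p))) := by
      intro p hp
      obtain ⟨q, rfl⟩ := Nat.exists_eq_add_of_le (Nat.lt_succ_iff.1 (Finset.mem_range.1 hp))
      have hq : N = (j + p) + (q + i) := by omega
      rw [key _ (Finset.mem_range.2 (by omega)) (q + i) hq, poch_neg_natCast, poch_neg_natCast,
        hahnW, show N - (j + p) = q + i by omega, show p + q - p = q by omega,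
        add_comm j p, poch_add (c - a), poch_add _ q i]
      have hcomb : (N.choose (p + j) : ℂ) * (p + j).descFactorial j * (q + i).descFactorial i =
          N.descFactorial (j + i) * (p + q).choose p := by
        rw [show N = (p + j) + (q + i) by omega]
        exact_mod_cast choose_mul_descFactorial_mul_descFactorial p j q i
      have e1 : poch (a - (c - 1) - (p + j : ℕ)) j = (-1) ^ j * poch (c - a + p) j := by
        rw [poch_reflect]
        congr 2
        push_cast
        ring
      have e2 : poch (1 - a - c - N + q) i =
          (-1) ^ i * poch (a - (-c - N) - ((N : ℂ) - (p + j : ℕ))) i := by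
        rw [poch_reflect]
        congr 2
        rw [hq]
        push_cast
        ring
      have n1 : poch (a - (c - 1) - (p + j : ℕ)) j ≠ 0 := by
        refine poch_ne_zero fun t ht => ?_
        convert h1 (p + j) (by omega) t (by omega) using 1
        ring
      have n2 : poch (a - (-c - N) - ((N : ℂ) - (p + j : ℕ))) i ≠ 0 := by
        refine poch_ne_zero fun t ht => ?_
        convert hac (p + j + t) (by omega) using 1
        push_cast
        ring
      rw [e1] at n1 ⊢
      rw [e2]
      have n1' := right_ne_zero_of_mul n1
      field_simp
      rw [← pow_mul, mul_comm i 2, pow_mul]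
      simp only [neg_one_sq, one_pow]
      linear_combination (poch (c - a) p * poch (1 - a - c - N) q) * hcomb
    rw [Finset.sum_congr rfl hterm, ← Finset.mul_sum, sum_choose_mul_poch_mul_poch,
      poch_neg_natCast, show N = (j + i) + M from hM, poch_add (2 * a) (j + i) M, ← hM,
      poch_reflect (2 * a + (j + i : ℕ)) M]
    have n3 : poch (2 * a) (j + i) ≠ 0 := poch_ne_zero fun t ht => hx t (by omega)
    have e3 : 1 - (2 * a + (j + i : ℕ)) - (M : ℂ) = c - a + (1 - a - c - N) := by
      rw [hM]
      push_cast
      ring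
    rw [e3]
    generalize poch (2 * a) (j + i) = P at n3 ⊢
    field_simp
    have e4 : ((-1 : ℂ) ^ N * (-1) ^ M) * (-1) ^ (j + i) = 1 := by
      rw [mul_assoc, ← pow_add, ← pow_add, show N + (M + (j + i)) = 2 * N by omega, pow_mul]
      simp
    linear_combination (-(poch (c - a + (1 - a - c - N)) M * N.descFactorial (j + i))) * e4

/-- The coefficients of `hahnU a c' N k`, which depend on `x = 2a` but not on `c'`. -/
noncomputable def hahnCoeff (x : ℂ) (N k j : ℕ) : ℂ :=
  poch (-(k : ℂ)) j * poch ((k : ℂ) + x - 1) j / (poch (-(N : ℂ)) j * (Nat.factorial j : ℂ))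

theorem hahnU_eq (a c' : ℂ) (N k : ℕ) (l : ℂ) :
    hahnU a c' N k l = ∑ j ∈ Finset.range (k + 1),
      hahnCoeff (2 * a) N k j * (poch (-l) j / poch (a - c' - l) j) := by
  refine Finset.sum_congr rfl fun j _ => ?_
  rw [hahnCoeff, div_mul_div_comm]
  congr 1 <;> ring

theorem sum_hahnCoeff_mul {x : ℂ} {N k j : ℕ} (hk : k ≤ N) (hj : j ≤ N)
    (hx : ∀ i < 2 * N, x + (i : ℂ) ≠ 0) :
    ∑ i ∈ Finset.range (k + 1),
        hahnCoeff x N k i * (poch (-(N : ℂ)) (j + i) / poch x (j + i)) =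
      poch (-(N : ℂ)) j * poch (x + N) k * poch (-(j : ℂ)) k /
        (poch (-(N : ℂ)) k * poch x (j + k)) := by
  have hS := sum_choose_saalschutz ((k : ℂ) + x - 1) (-(N : ℂ) + j) (-(N : ℂ)) k
  have e1 : poch (-(N : ℂ) - ((k : ℂ) + x - 1)) k = (-1) ^ k * poch (x + N) k := by
    rw [poch_reflect]
    congr 2
    ring
  rw [e1, show -(N : ℂ) - (-(N : ℂ) + j) = -j by ring] at hS
  have hxk : poch x (j + k) ≠ 0 := poch_ne_zero fun t ht => hx t (by omega)
  have hNk := poch_neg_natCast_ne_zero hk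
  rw [eq_div_iff (mul_ne_zero hNk hxk)]
  have e2 : (-1 : ℂ) ^ k * (-1) ^ k = 1 := by simp [← mul_pow]
  calc _ = (-1) ^ k * poch (-(N : ℂ)) j * ((-1) ^ k * poch (x + N) k * poch (-(j : ℂ)) k) := by
        rw [← hS, Finset.sum_mul, Finset.mul_sum]
        refine Finset.sum_congr rfl fun i hi => ?_
        obtain ⟨m, rfl⟩ := Nat.exists_eq_add_of_le (Nat.lt_succ_iff.1 (Finset.mem_range.1 hi))
        have hxi : poch x (j + i) ≠ 0 := poch_ne_zero fun t ht => hx t (by omega)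
        have hNi := poch_neg_natCast_ne_zero (show i ≤ N by omega)
        have hf : (Nat.factorial i : ℂ) ≠ 0 := by exact_mod_cast i.factorial_ne_zero
        have e3 : poch (-(N : ℂ) - (((i + m : ℕ) : ℂ) + x - 1) - (-(N : ℂ) + j)) m =
            (-1) ^ m * poch (x + (j + i : ℕ)) m := by
          rw [poch_reflect]
          congr 2
          push_cast
          ring
        rw [show i + m - i = m by omega, e3, hahnCoeff, poch_neg_natCast (i + m) i,
          Nat.descFactorial_eq_factorial_mul_choose, poch_add (-(N : ℂ)) j i,
          poch_add (-(N : ℂ)) i m, ← add_assoc j i m, poch_add x (j + i) m]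
        push_cast
        field_simp
        ring_nf
        simp
    _ = _ := by linear_combination (poch (-(N : ℂ)) j * poch (x + N) k * poch (-(j : ℂ)) k) * e2

theorem sum_hahnCoeff_mul_hahnCoeff_of_le {x : ℂ} {N s k : ℕ} (hk : k ≤ N) (hsk : s ≤ k)
    (hx : ∀ i < 2 * N, x + (i : ℂ) ≠ 0) :
    ∑ j ∈ Finset.range (s + 1), ∑ i ∈ Finset.range (k + 1),
        hahnCoeff x N s j * hahnCoeff x N k i * (poch (-(N : ℂ)) (j + i) / poch x (j + i)) =
      if k = s then (Nat.factorial k : ℂ) * poch (x + N) k * poch ((k : ℂ) + x - 1) k /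
        (poch (-(N : ℂ)) k * poch x (k + k)) else 0 := by
  have h : ∀ j ∈ Finset.range (s + 1), ∑ i ∈ Finset.range (k + 1),
        hahnCoeff x N s j * hahnCoeff x N k i * (poch (-(N : ℂ)) (j + i) / poch x (j + i)) =
      hahnCoeff x N s j * (poch (-(N : ℂ)) j * poch (x + N) k * poch (-(j : ℂ)) k /
        (poch (-(N : ℂ)) k * poch x (j + k))) := by
    intro j hj
    have hj := Finset.mem_range.1 hj
    rw [← sum_hahnCoeff_mul hk (by omega) hx, Finset.mul_sum]
    exact Finset.sum_congr rfl fun i _ => mul_assoc _ _ _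
  rw [Finset.sum_congr rfl h, Finset.sum_range_succ, Finset.sum_eq_zero, zero_add]
  · split_ifs with hks
    · subst hks
      have hNk := poch_neg_natCast_ne_zero hk
      have hxk : poch x (k + k) ≠ 0 := poch_ne_zero fun t ht => hx t (by omega)
      have hf : (Nat.factorial k : ℂ) ≠ 0 := by exact_mod_cast k.factorial_ne_zero
      have e2 : (-1 : ℂ) ^ k * (-1) ^ k = 1 := by simp [← mul_pow]
      rw [hahnCoeff, poch_neg_natCast k k, Nat.descFactorial_self]
      field_simp
      linear_combination (poch ((k : ℂ) + x - 1) k * poch (x + N) k) * e2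
    · rw [poch_neg_natCast_eq_zero (show s < k by omega)]
      simp
  · intro j hj
    rw [poch_neg_natCast_eq_zero (show j < k by have := Finset.mem_range.1 hj; omega)]
    simp

theorem sum_hahnCoeff_mul_hahnCoeff {x : ℂ} {N s k : ℕ} (hs : s ≤ N) (hk : k ≤ N)
    (hx : ∀ i < 2 * N, x + (i : ℂ) ≠ 0) :
    ∑ j ∈ Finset.range (s + 1), ∑ i ∈ Finset.range (k + 1),
        hahnCoeff x N s j * hahnCoeff x N k i * (poch (-(N : ℂ)) (j + i) / poch x (j + i)) =
      if k = s then (Nat.factorial k : ℂ) * poch (x + N) k * poch ((k : ℂ) + x - 1) k /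
        (poch (-(N : ℂ)) k * poch x (k + k)) else 0 := by
  rcases le_or_gt s k with h | h
  · exact sum_hahnCoeff_mul_hahnCoeff_of_le hk h hx
  · have hks := sum_hahnCoeff_mul_hahnCoeff_of_le hs h.le hx
    rw [if_neg h.ne'] at hks
    rw [if_neg h.ne, Finset.sum_comm, ← hks]
    refine Finset.sum_congr rfl fun i _ => Finset.sum_congr rfl fun j _ => ?_
    rw [add_comm j i, mul_comm (hahnCoeff x N s j)]

/-- Biorthogonality of the Hahn rational functions:
`Σ_{ℓ=0}^{N} W(ℓ) U_s(ℓ; a, c-1, N) Uₖ(N-ℓ; a, -c-N, N) = hₖ δ_{k,s}`. -/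
theorem hahn_rational_biorthogonality (a c : ℂ) (N : ℕ) (hN : 1 ≤ N)
    (hac : ∀ m ≤ 2 * N, a + c + (m : ℂ) ≠ 0)
    (h1 : ∀ l ≤ N, ∀ i ≤ N - 1, a - c + 1 - (l : ℂ) + (i : ℂ) ≠ 0)
    (h2 : ∀ i ≤ N - 1, 2 * a + (i : ℂ) ≠ 0)
    (h3 : ∀ i ≤ N - 1, 2 * a + (N : ℂ) + (i : ℂ) ≠ 0)
    (h4 : ∀ k ≤ N, 2 * a - 1 - 2 * (k : ℂ) ≠ 0)
    (h5 : ∀ k ≤ N, ∀ j ≤ N + 1, poch ((k : ℂ) + 2 * a - 1) j ≠ 0)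
    (s k : ℕ) (hs : s ≤ N) (hk : k ≤ N) :
    ∑ l ∈ Finset.range (N + 1),
        hahnW a c N l * hahnU a (c - 1) N s (l : ℂ)
          * hahnU a (-c - N) N k ((N : ℂ) - l)
      = if k = s then hahnH a N k else 0 := by
  have hx : ∀ i < 2 * N, 2 * a + (i : ℂ) ≠ 0 := by
    intro i hi
    rcases lt_or_ge i N with h | h
    · exact h2 i (by omega)
    · obtain ⟨t, rfl⟩ := Nat.exists_eq_add_of_le h
      have := h3 t (by omega)
      push_cast
      rwa [← add_assoc]
  have hexp : ∑ l ∈ Finset.range (N + 1),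
        hahnW a c N l * hahnU a (c - 1) N s (l : ℂ)
          * hahnU a (-c - N) N k ((N : ℂ) - l) =
      (-1) ^ N * poch (2 * a) N * ∑ j ∈ Finset.range (s + 1), ∑ i ∈ Finset.range (k + 1),
        hahnCoeff (2 * a) N s j * hahnCoeff (2 * a) N k i *
          (poch (-(N : ℂ)) (j + i) / poch (2 * a) (j + i)) := by
    simp only [hahnU_eq, Finset.mul_sum, Finset.sum_mul]
    rw [Finset.sum_congr rfl fun l _ => Finset.sum_comm, Finset.sum_comm]
    refine Finset.sum_congr rfl fun j hj => ?_
    rw [Finset.sum_comm]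
    refine Finset.sum_congr rfl fun i hi => ?_
    rw [mul_left_comm, ← sum_hahnW_mul a c N i j hac h1 hx, Finset.mul_sum]
    exact Finset.sum_congr rfl fun l _ => by ring
  rw [hexp, sum_hahnCoeff_mul_hahnCoeff hs hk hx]
  split_ifs with hks
  · have hN := poch_neg_natCast_ne_zero hk
    have hxk : poch (2 * a) (k + k) ≠ 0 := poch_ne_zero fun t ht => hx t (by omega)
    have h0 : poch (2 * a - 1) k ≠ 0 := by
      simpa using h5 0 (Nat.zero_le N) k (by omega)
    have hk1 := h5 k hk (k + 1) (by omega)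
    rw [poch_succ] at hk1
    have hd : 1 - 2 * a - 2 * (k : ℂ) ≠ 0 := fun h =>
      right_ne_zero_of_mul hk1 (by linear_combination -h)
    have e1 : poch (2 * a - 1) (k + k + 1) =
        poch (2 * a - 1) k * poch (k + 2 * a - 1) k * (2 * a - 1 + (k + k : ℕ)) := by
      rw [poch_succ, poch_add]
      congr 3
      ring
    rw [poch_succ_left, sub_add_cancel] at e1
    push_cast at e1
    rw [hahnH]
    field_simp
    linear_combination (poch (2 * a) N * (Nat.factorial k : ℂ) * poch (2 * a + N) k) * e1
  · simp
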